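/- arXiv:1307.2959 — 4 statements merged into one kernel-verified Lean document; each statement's English description precedes it below -/
import Mathlib

section
/- For every α > 0 and T₀ > 0 there exists a unique function ξ : [0, T₀] → ℝ that is continuous on [0, T₀], twice continuously differentiable on (0, T₀], and satisfies: ξ(0) = 0, ξ(t) > 0 for t ∈ (0, T₀], ξ'(t) > 0 for all t ∈ (0, T₀), ξ'(T₀) = 0, and ξ''(t) = −α ξ(t)⁻² on (0, T₀]. (This is the degenerate collinear Kepler arc of the problem d²ξ/dt² = −α ξ⁻².) -/
open Real Set

noncomputable section

/-- `ξ` is the degenerate collinear Kepler arc on `[0, T₀]` for the problem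
`ξ'' = -α ξ⁻²`: it is continuous on `[0, T₀]`, twice continuously differentiable
on `(0, T₀]` (with derivative `ξ'`), vanishes at `0`, is positive on `(0, T₀]`,
strictly increasing on `(0, T₀)`, and has vanishing velocity at `T₀`. -/
def IsKeplerArc (α T₀ : ℝ) (ξ : ℝ → ℝ) : Prop :=
  ContinuousOn ξ (Icc 0 T₀) ∧
  ξ 0 = 0 ∧
  (∀ t ∈ Ioc 0 T₀, 0 < ξ t) ∧
  ∃ ξ' : ℝ → ℝ,
    (∀ t ∈ Ioc 0 T₀, HasDerivWithinAt ξ (ξ' t) (Icc 0 T₀) t) ∧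
    ContinuousOn ξ' (Ioc 0 T₀) ∧
    (∀ t ∈ Ioo 0 T₀, 0 < ξ' t) ∧
    ξ' T₀ = 0 ∧
    (∀ t ∈ Ioc 0 T₀, HasDerivWithinAt ξ' (-α / ξ t ^ 2) (Icc 0 T₀) t)

theorem eq_of_hasDerivAt_zero {f : ℝ → ℝ} {a b : ℝ} (hab : a ≤ b)
    (hf : ContinuousOn f (Icc a b)) (hf' : ∀ x ∈ Ioo a b, HasDerivAt f 0 x) : f b = f a := by
  rcases hab.eq_or_lt with rfl | hab
  · rfl
  obtain ⟨c, -, hc⟩ := exists_hasDerivAt_eq_slope f (fun _ => 0) hab hf hf'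
  have : b - a ≠ 0 := by linarith
  field_simp at hc
  linarith

theorem strictMono_sub_sin : StrictMono fun x : ℝ => x - sin x := by
  intro x y hxy
  have h := Real.sin_sub_sin y x
  have h2 := Real.abs_cos_le_one ((y + x) / 2)
  have h3 : |sin ((y - x) / 2)| < (y - x) / 2 := by
    have hpos : 0 < (y - x) / 2 := by linarith
    exact (Real.abs_sin_lt_abs hpos.ne').trans_eq (abs_of_pos hpos)
  have h4 := (le_abs_self _).trans_eq (abs_mul (sin ((y - x) / 2)) (cos ((y + x) / 2)))
  change x - sin x < y - sin y
  nlinarith [mul_le_of_le_one_right (abs_nonneg (sin ((y - x) / 2))) h2]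

/-- The inverse of `x ↦ x - sin x`, together with its differential equation. -/
theorem exists_inverse_sub_sin : ∃ Θ : ℝ → ℝ, StrictMono Θ ∧ Continuous Θ ∧
    (∀ x, Θ (x - sin x) = x) ∧
    ∀ y, cos (Θ y) ≠ 1 → HasDerivAt Θ (1 - cos (Θ y))⁻¹ y := by
  have hsurj : Function.Surjective fun x : ℝ => x - sin x := by
    refine Continuous.surjective (by fun_prop) ?_ ?_
    · exact Filter.tendsto_atTop_mono (fun x => by simp only [id]; linarith [Real.sin_le_one x])
        (Filter.tendsto_atTop_add_const_right _ (-1 : ℝ) Filter.tendsto_id)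
    · exact Filter.tendsto_atBot_mono (fun x => by simp only [id]; linarith [Real.neg_one_le_sin x])
        (Filter.tendsto_atBot_add_const_right _ (1 : ℝ) Filter.tendsto_id)
  let e := strictMono_sub_sin.orderIsoOfSurjective _ hsurj
  have he : ∀ x, e x = x - sin x := fun _ => rfl
  refine ⟨e.symm, e.symm.strictMono, e.symm.continuous, fun x => by rw [← he, e.symm_apply_apply],
    fun y hy => ?_⟩
  refine HasDerivAt.of_local_left_inverse (f := fun x => x - sin x)
    e.symm.continuous.continuousAt ?_ (by intro h; exact hy (by linarith))
    (Filter.Eventually.of_forall fun z => e.apply_symm_apply z)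
  exact (hasDerivAt_id _).sub (Real.hasDerivAt_sin _)

namespace IsKeplerArc

variable {α T₀ : ℝ} {ζ : ℝ → ℝ}

theorem strictMonoOn (h : IsKeplerArc α T₀ ζ) : StrictMonoOn ζ (Icc 0 T₀) := by
  obtain ⟨hc, -, -, v, hv, -, hvpos, -, -⟩ := h
  refine strictMonoOn_of_deriv_pos (convex_Icc _ _) hc fun t ht => ?_
  rw [interior_Icc] at ht
  rw [((hv t (Ioo_subset_Ioc_self ht)).hasDerivAt (Icc_mem_nhds ht.1 ht.2)).deriv]
  exact hvpos t ht

/-- Conservation of energy. -/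
theorem exists_velocity_sq (h : IsKeplerArc α T₀ ζ) :
    ∃ v : ℝ → ℝ, ∀ t ∈ Ioo 0 T₀, HasDerivAt ζ (v t) t ∧ 0 < v t ∧
      v t ^ 2 = 2 * α * (1 / ζ t - 1 / ζ T₀) := by
  obtain ⟨hc, -, hpos, v, hv, hvc, hvpos, hvT, ha⟩ := h
  have hd : ∀ t ∈ Ioo 0 T₀, HasDerivAt ζ (v t) t := fun t ht =>
    (hv t (Ioo_subset_Ioc_self ht)).hasDerivAt (Icc_mem_nhds ht.1 ht.2)
  refine ⟨v, fun t ht => ⟨hd t ht, hvpos t ht, ?_⟩⟩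
  have hsub : Icc t T₀ ⊆ Ioc 0 T₀ := fun s hs => ⟨ht.1.trans_le hs.1, hs.2⟩
  have key := eq_of_hasDerivAt_zero (f := fun s => v s ^ 2 - 2 * α * (ζ s)⁻¹) ht.2.le
    (((hvc.mono hsub).pow 2).sub (continuousOn_const.mul
      ((hc.mono (hsub.trans Ioc_subset_Icc_self)).inv₀ fun s hs => (hpos s (hsub hs)).ne')))
    (fun s hs => by
      have hs' : s ∈ Ioo 0 T₀ := ⟨ht.1.trans hs.1, hs.2⟩
      have hne := (hpos s (Ioo_subset_Ioc_self hs')).ne'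
      have hdv := (ha s (Ioo_subset_Ioc_self hs')).hasDerivAt (Icc_mem_nhds hs'.1 hs'.2)
      refine HasDerivAt.congr_deriv ((hdv.pow 2).sub (((hd s hs').inv hne).const_mul (2 * α))) ?_
      field_simp
      ring)
  simp only [hvT] at key
  simp only [one_div]
  linarith

/-- Every arc is half an arch of a cycloid. -/
theorem exists_cycloid (hα : 0 < α) (hT : 0 < T₀) (h : IsKeplerArc α T₀ ζ) :
    ∃ a : ℝ, 0 < a ∧ a ^ 3 = α * (T₀ / π) ^ 2 ∧
      ∀ t ∈ Icc 0 T₀, ∃ θ, ζ t = a * (1 - cos θ) ∧ θ - sin θ = t / (T₀ / π) := by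
  have hmono := h.strictMonoOn
  obtain ⟨v, hv⟩ := h.exists_velocity_sq
  obtain ⟨hc, h0, hpos, -⟩ := h
  have hM := hpos T₀ ⟨hT, le_rfl⟩
  obtain ⟨a, haM⟩ : ∃ a, ζ T₀ = 2 * a := ⟨ζ T₀ / 2, by ring⟩
  have ha : 0 < a := by linarith
  obtain ⟨b, hb, hb2⟩ : ∃ b, 0 < b ∧ α * b ^ 2 = a ^ 3 := by
    refine ⟨√(a ^ 3 / α), by positivity, ?_⟩
    rw [Real.sq_sqrt (by positivity)]
    field_simp
  set θ : ℝ → ℝ := fun t => arccos (1 - ζ t / a) with hθ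
  have hθc : ContinuousOn θ (Icc 0 T₀) :=
    Real.continuous_arccos.comp_continuousOn (continuousOn_const.sub (hc.div_const a))
  have hderiv : ∀ t ∈ Ioo 0 T₀, HasDerivAt (fun t => b * (θ t - sin (θ t)) - t) 0 t := by
    intro t ht
    obtain ⟨hd, hvpos, hv2⟩ := hv t ht
    have hz := hpos t (Ioo_subset_Ioc_self ht)
    have hzM : ζ t < 2 * a :=
      haM ▸ hmono (Ioo_subset_Icc_self ht) (right_mem_Icc.2 hT.le) ht.2
    have hza : 0 < ζ t / a := by positivity
    have hza2 : ζ t / a < 2 := by rwa [div_lt_iff₀ ha]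
    have hθd : HasDerivAt θ (-(1 / √(1 - (1 - ζ t / a) ^ 2)) * -(v t / a)) t :=
      HasDerivAt.comp (h₂ := arccos) t
        (Real.hasDerivAt_arccos (by linarith) (by linarith)) ((hd.div_const a).const_sub 1)
    have hcos : cos (θ t) = 1 - ζ t / a := Real.cos_arccos (by linarith) (by linarith)
    have hs2 : 0 < 1 - (1 - ζ t / a) ^ 2 := by nlinarith
    have hspeed : b * ζ t * v t = a ^ 2 * √(1 - (1 - ζ t / a) ^ 2) := by
      refine (pow_left_inj₀ (by positivity) (by positivity) two_ne_zero).1 ?_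
      rw [mul_pow, mul_pow, mul_pow, Real.sq_sqrt hs2.le, hv2, haM]
      have : b ^ 2 = a ^ 3 / α := by rw [← hb2]; field_simp
      rw [this]
      field_simp
      ring
    have hs : √(1 - (1 - ζ t / a) ^ 2) ≠ 0 := (Real.sqrt_pos.2 hs2).ne'
    refine HasDerivAt.congr_deriv (((hθd.sub hθd.sin).const_mul b).sub (hasDerivAt_id t)) ?_
    rw [hcos]
    generalize √(1 - (1 - ζ t / a) ^ 2) = s at *
    field_simp
    linear_combination hspeed
  have hconst : ∀ t ∈ Icc 0 T₀, b * (θ t - sin (θ t)) = t := by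
    intro t ht
    have hsub : Icc 0 t ⊆ Icc 0 T₀ := Icc_subset_Icc_right ht.2
    have hθt := hθc.mono hsub
    have := eq_of_hasDerivAt_zero ht.1
      ((continuousOn_const.mul (hθt.sub (Real.continuous_sin.comp_continuousOn hθt))).sub continuousOn_id)
      fun s hs => hderiv s ⟨hs.1, hs.2.trans_le ht.2⟩
    simp [hθ, h0] at this
    simp only [hθ]
    linarith
  have hbT : b = T₀ / π := by
    have := hconst T₀ (right_mem_Icc.2 hT.le)
    have hu : 1 - 2 * a / a = -1 := by field_simp; norm_num
    simp only [hθ, haM, hu, Real.arccos_neg_one, Real.sin_pi, sub_zero] at this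
    rw [← this]
    field_simp
  refine ⟨a, ha, by rw [← hbT, hb2], fun t ht => ⟨θ t, ?_, ?_⟩⟩
  · have h1 : 0 ≤ ζ t := h0 ▸ hmono.monotoneOn (left_mem_Icc.2 hT.le) ht ht.1
    have h2 : ζ t ≤ 2 * a := haM ▸ hmono.monotoneOn ht (right_mem_Icc.2 hT.le) ht.2
    have h3 : 0 ≤ ζ t / a := by positivity
    have h4 : ζ t / a ≤ 2 := by rwa [div_le_iff₀ ha]
    rw [hθ, Real.cos_arccos (by linarith) (by linarith)]
    field_simp
    ring
  · rw [← hbT, eq_div_iff hb.ne', mul_comm]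
    exact hconst t ht

theorem eqOn {ξ : ℝ → ℝ} (hα : 0 < α) (hT : 0 < T₀) (hζ : IsKeplerArc α T₀ ζ)
    (hξ : IsKeplerArc α T₀ ξ) : EqOn ζ ξ (Icc 0 T₀) := by
  obtain ⟨a, ha, ha3, hζ⟩ := hζ.exists_cycloid hα hT
  obtain ⟨a', ha', ha3', hξ⟩ := hξ.exists_cycloid hα hT
  have haa : a = a' := (pow_left_inj₀ ha.le ha'.le three_ne_zero).1 (ha3.trans ha3'.symm)
  intro t ht
  obtain ⟨θ, h1, h2⟩ := hζ t ht
  obtain ⟨θ', h1', h2'⟩ := hξ t ht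
  have : θ = θ' := strictMono_sub_sin.injective (h2.trans h2'.symm)
  rw [h1, h1', haa, this]

end IsKeplerArc

theorem exists_isKeplerArc {α T₀ : ℝ} (hα : 0 < α) (hT : 0 < T₀) :
    ∃ ξ : ℝ → ℝ, IsKeplerArc α T₀ ξ := by
  obtain ⟨Θ, hmono, hcont, hinv, hderiv⟩ := exists_inverse_sub_sin
  obtain ⟨b, hb, hbT⟩ : ∃ b, 0 < b ∧ T₀ / b = π :=
    ⟨T₀ / π, div_pos hT Real.pi_pos, by field_simp⟩
  obtain ⟨a, ha, ha3⟩ : ∃ a, 0 < a ∧ a ^ 3 = α * b ^ 2 := by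
    refine ⟨(α * b ^ 2) ^ (3⁻¹ : ℝ), by positivity, ?_⟩
    exact_mod_cast Real.rpow_inv_natCast_pow (n := 3) (by positivity) three_ne_zero
  have hΘ0 : Θ 0 = 0 := by simpa using hinv 0
  have hΘT : Θ (T₀ / b) = π := by simpa [hbT] using hinv π
  set φ : ℝ → ℝ := fun t => Θ (t / b) with hφ
  have hφmono : StrictMono φ := fun s t hst => hmono (div_lt_div_of_pos_right hst hb)
  have hφ0 : φ 0 = 0 := by simp [hφ, hΘ0]
  have hφpos : ∀ t ∈ Ioc 0 T₀, 0 < φ t := fun t ht => hφ0 ▸ hφmono ht.1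
  have hφle : ∀ t ∈ Ioc 0 T₀, φ t ≤ π := fun t ht => hΘT ▸ hφmono.monotone ht.2
  have hcos : ∀ t ∈ Ioc 0 T₀, 0 < 1 - cos (φ t) := by
    intro t ht
    have := Real.cos_lt_cos_of_nonneg_of_le_pi le_rfl (hφle t ht) (hφpos t ht)
    rw [Real.cos_zero] at this
    linarith
  have hφd : ∀ t ∈ Ioc 0 T₀, HasDerivAt φ ((1 - cos (φ t))⁻¹ * (1 / b)) t := by
    intro t ht
    have hne : cos (Θ (t / b)) ≠ 1 := by
      have := hcos t ht
      simp only [hφ] at this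
      linarith
    exact (hderiv (t / b) hne).comp t ((hasDerivAt_id t).div_const b)
  have hφc : Continuous φ := hcont.comp (continuous_id.div_const b)
  have hvd : ∀ t ∈ Ioc 0 T₀, HasDerivAt (fun t => a / b * (sin (φ t) / (1 - cos (φ t))))
      (-α / (a * (1 - cos (φ t))) ^ 2) t := by
    intro t ht
    have hne := (hcos t ht).ne'
    refine HasDerivAt.congr_deriv (((hφd t ht).sin.div ((hφd t ht).cos.const_sub 1) hne).const_mul (a / b)) ?_
    have hα' : α = a ^ 3 / b ^ 2 := by rw [ha3]; field_simp
    rw [hα']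
    have hsc := Real.sin_sq_add_cos_sq (φ t)
    field_simp
    linear_combination -hsc
  refine ⟨fun t => a * (1 - cos (φ t)), by fun_prop, by simp [hφ0],
    fun t ht => mul_pos ha (hcos t ht), fun t => a / b * (sin (φ t) / (1 - cos (φ t))),
    fun t ht => ?_, fun t ht => (hvd t ht).continuousAt.continuousWithinAt, fun t ht => ?_,
    by simp [hφ, hΘT], fun t ht => (hvd t ht).hasDerivWithinAt⟩
  · refine HasDerivAt.hasDerivWithinAt ?_
    refine HasDerivAt.congr_deriv (((hφd t ht).cos.const_sub 1).const_mul a) ?_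
    field_simp
  · have ht' := Ioo_subset_Ioc_self ht
    have hlt : φ t < π := hΘT ▸ hφmono ht.2
    have := Real.sin_pos_of_pos_of_lt_pi (hφpos t ht') hlt
    have := hcos t ht'
    positivity

/-- Existence and uniqueness of the degenerate collinear Kepler arc. -/
theorem kepler_arc_exists_unique (α T₀ : ℝ) (hα : 0 < α) (hT : 0 < T₀) :
    ∃ ξ : ℝ → ℝ, IsKeplerArc α T₀ ξ ∧
      ∀ ζ : ℝ → ℝ, IsKeplerArc α T₀ ζ → EqOn ζ ξ (Icc 0 T₀) := by
  obtain ⟨ξ, hξ⟩ := exists_isKeplerArc hα hT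
  exact ⟨ξ, hξ, fun ζ hζ => hζ.eqOn hα hT hξ⟩

end
end

section
/- Let α > 0 and T₀ > 0. For every absolutely continuous function ξ : [0, T₀] → ℝ whose derivative is square-integrable and which vanishes at some point, i.e. ξ(t₀) = 0 for some t₀ ∈ [0, T₀], the Kepler action satisfies ∫₀^{T₀} ( (1/2) ξ'(t)² + α/|ξ(t)| ) dt ≥ (3/2) · π^{2/3} · α^{2/3} · T₀^{1/3} (where the integrand is interpreted as +∞ where ξ vanishes, so the integral may be infinite). -/
open Real Set MeasureTheory

noncomputable section

/-- Composing an absolutely continuous function with a `C¹` function on a compact convex set gives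
an absolutely continuous function. -/
theorem AbsolutelyContinuousOnInterval.comp_contDiffOn {f φ : ℝ → ℝ} {a b : ℝ} {s : Set ℝ}
    (hf : AbsolutelyContinuousOnInterval f a b) (hs : Convex ℝ s) (hs' : IsCompact s)
    (hφ : ContDiffOn ℝ 1 φ s) (hfs : MapsTo f (uIcc a b) s) :
    AbsolutelyContinuousOnInterval (fun x => φ (f x)) a b := by
  obtain ⟨K, hK⟩ := hφ.exists_lipschitzOnWith (by decide) hs hs'
  rw [absolutelyContinuousOnInterval_iff] at hf ⊢
  intro ε hε
  obtain ⟨δ, hδ, h⟩ := hf (ε / (K + 1)) (by positivity)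
  refine ⟨δ, hδ, fun E hE hlen => ?_⟩
  have hE' := h E hE hlen
  rw [lt_div_iff₀ (by positivity)] at hE'
  refine lt_of_le_of_lt ?_ hE'
  rw [Finset.sum_mul]
  refine Finset.sum_le_sum fun i hi => ?_
  have hmem := hE.1 i hi
  have := hK.dist_le_mul _ (hfs hmem.1) _ (hfs hmem.2)
  nlinarith [dist_nonneg (x := f (E.2 i).1) (y := f (E.2 i).2)]

/-- Weighted arithmetic-geometric mean inequality for the period of a Kepler arc. -/
theorem three_halves_rpow_le_mul_add {α k L S : ℝ} (hα : 0 < α) (hk : 0 < k) (hL : 0 < L)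
    (hS : 0 < S) :
    (3/2) * k ^ ((2:ℝ)/3) * α ^ ((2:ℝ)/3) * L ^ ((1:ℝ)/3) ≤ α * S + k ^ 2 * L / (2 * S ^ 2) := by
  have h := Real.geom_mean_le_arith_mean2_weighted (w₁ := 2/3) (w₂ := 1/3) (p₁ := α * S)
    (p₂ := k ^ 2 * L / S ^ 2) (by norm_num) (by norm_num) (by positivity) (by positivity)
    (by norm_num)
  have e : (α * S) ^ ((2:ℝ)/3) * (k ^ 2 * L / S ^ 2) ^ ((1:ℝ)/3)
      = k ^ ((2:ℝ)/3) * α ^ ((2:ℝ)/3) * L ^ ((1:ℝ)/3) := by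
    have sq (x : ℝ) (hx : 0 < x) : (x ^ 2) ^ ((1:ℝ)/3) = x ^ ((2:ℝ)/3) := by
      rw [← Real.rpow_natCast, ← Real.rpow_mul hx.le]; norm_num
    rw [Real.mul_rpow hα.le hS.le, Real.div_rpow (by positivity) (by positivity),
      Real.mul_rpow (by positivity) hL.le, sq k hk, sq S hS]
    have : 0 < S ^ ((2:ℝ)/3) := by positivity
    field_simp
  rw [e] at h
  have e2 : k ^ 2 * L / (2 * S ^ 2) = (k ^ 2 * L / S ^ 2) / 2 := by field_simp
  rw [e2]
  linarith

/-- Calibration estimate for the Kepler action of a path starting at the origin, with the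
potential `α / |f|` regularized to `α / √(f² + δ²)`. -/
theorem regularized_kepler_action_lower_bound {α L δ κ : ℝ} (hL : 0 < L) (hδ : 0 < δ)
    (hκ : 0 < κ) (hκ' : κ < π / 2) {v : ℝ → ℝ} (hv : Integrable v)
    (hv2 : Integrable (fun t => v t ^ 2)) {f : ℝ → ℝ} (hf : ∀ t, f t = ∫ s in (0:ℝ)..t, v s)
    {S : ℝ} (hS : S = ∫ t in (0:ℝ)..L, (√(f t ^ 2 + δ ^ 2))⁻¹) (hS0 : 0 < S) :
    α * S + 2 * (κ / S) ^ 2 * L - 2 * (κ / S) * (tan κ * δ) ≤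
      ∫ t in (0:ℝ)..L, ((1/2) * v t ^ 2 + α / √(f t ^ 2 + δ ^ 2)) := by
  have hfe : f = fun t => ∫ s in (0:ℝ)..t, v s := funext hf
  have hfc : Continuous f := by
    rw [hfe]; exact intervalIntegral.continuous_primitive (fun a b => hv.intervalIntegrable) 0
  have hfac : AbsolutelyContinuousOnInterval f 0 L := by
    rw [hfe]
    exact hv.intervalIntegrable.absolutelyContinuousOnInterval_intervalIntegral (by simp)
  have hfd : ∀ᵐ t, HasDerivAt f (v t) t := by
    filter_upwards [_root_.LocallyIntegrable.ae_hasDerivAt_integral hv.locallyIntegrable] with t ht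
    rw [hfe]; exact ht 0
  have hpos (x : ℝ) : 0 < x ^ 2 + δ ^ 2 := by positivity
  set g : ℝ → ℝ := fun t => √(f t ^ 2 + δ ^ 2) with hg
  have hg0 (t : ℝ) : 0 < g t := Real.sqrt_pos.2 (hpos _)
  have hgsq (t : ℝ) : g t ^ 2 = f t ^ 2 + δ ^ 2 := Real.sq_sqrt (hpos _).le
  have hgc : Continuous g := by fun_prop
  have hgic : Continuous fun t => (g t)⁻¹ := hgc.inv₀ fun t => (hg0 t).ne'
  have hgac : AbsolutelyContinuousOnInterval g 0 L := by
    obtain ⟨C, hC⟩ := hfac.exists_bound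
    refine hfac.comp_contDiffOn (φ := fun x => √(x ^ 2 + δ ^ 2)) (convex_Icc (-C) C)
      isCompact_Icc ?_ fun x hx => abs_le.1 (hC x hx)
    exact ContDiff.contDiffOn (ContDiff.sqrt (by fun_prop) fun x => (hpos x).ne')
  set ω := κ / S with hω
  have hω0 : 0 < ω := by positivity
  set θ : ℝ → ℝ := fun t => ω * (S - ∫ s in (0:ℝ)..t, (g s)⁻¹) with hθ
  have hθd (t : ℝ) : HasDerivAt θ (-(ω * (g t)⁻¹)) t := by
    have := ((hgic.integral_hasStrictDerivAt 0 t).hasDerivAt.const_sub S).const_mul ω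
    simpa [hθ] using this
  have hθ0 : θ 0 = κ := by simp [hθ, hω]; field_simp
  have hθL : θ L = 0 := by simp [hθ, hS, hg]
  have hθanti : Antitone θ := antitone_of_deriv_nonpos (fun t => (hθd t).differentiableAt)
    fun t => by rw [(hθd t).deriv]; have := hg0 t; simp; positivity
  have hθmem : MapsTo θ (uIcc 0 L) (Icc 0 κ) := by
    intro t ht
    rw [uIcc_of_le hL.le] at ht
    exact ⟨hθL ▸ hθanti ht.2, hθ0 ▸ hθanti ht.1⟩
  have hcos : ∀ x ∈ Icc 0 κ, cos x ≠ 0 := fun x hx =>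
    (cos_pos_of_mem_Ioo ⟨by linarith [hx.1, pi_pos], by linarith [hx.2]⟩).ne'
  have hθac : AbsolutelyContinuousOnInterval θ 0 L := by
    apply ContDiffOn.absolutelyContinuousOnInterval
    apply ContDiff.contDiffOn
    rw [contDiff_one_iff_deriv]
    refine ⟨fun t => (hθd t).differentiableAt, ?_⟩
    rw [show deriv θ = _ from funext fun t => (hθd t).deriv]
    fun_prop
  have hcac : AbsolutelyContinuousOnInterval (fun t => tan (θ t)) 0 L :=
    hθac.comp_contDiffOn (φ := tan) (convex_Icc 0 κ) isCompact_Icc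
      (fun x hx => (contDiffAt_tan.2 (hcos x hx)).contDiffWithinAt) hθmem
  have hHac := hcac.fun_mul hgac
  have hHint := hHac.intervalIntegrable_deriv
  have hFTC := hHac.integral_deriv_eq_sub
  have hg00 : g 0 = δ := by simp [hg, hf, Real.sqrt_sq hδ.le]
  simp only [hθ0, hθL, tan_zero, zero_mul, hg00, zero_sub] at hFTC
  have hαg : IntervalIntegrable (fun t => α / g t) volume 0 L := by
    apply Continuous.intervalIntegrable
    simp only [div_eq_mul_inv]
    exact continuous_const.mul hgic
  have hαS : ∫ t in (0:ℝ)..L, α / g t = α * S := by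
    simp only [div_eq_mul_inv]
    rw [intervalIntegral.integral_const_mul, ← hS]
  have hlhs : α * S + 2 * ω ^ 2 * L - 2 * ω * (tan κ * δ) =
      ∫ t in (0:ℝ)..L, (2 * ω * deriv (fun t => tan (θ t) * g t) t + 2 * ω ^ 2 + α / g t) := by
    rw [intervalIntegral.integral_add ((hHint.const_mul _).add (by simp)) hαg,
      intervalIntegral.integral_add (hHint.const_mul _) (by simp),
      intervalIntegral.integral_const_mul, hFTC, hαS]
    simp
    ring
  rw [hlhs]
  refine intervalIntegral.integral_mono_ae_restrict hL.le
    (((hHint.const_mul _).add (by simp)).add hαg)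
    ((hv2.intervalIntegrable.const_mul _).add hαg) ?_
  filter_upwards [ae_restrict_of_ae hfd, ae_restrict_mem measurableSet_Icc] with t ht htm
  have hc := hcos _ (hθmem (by rwa [uIcc_of_le hL.le]))
  have hgd : HasDerivAt g (f t * v t / g t) t := by
    have := ((ht.pow 2).add_const (δ ^ 2)).sqrt (hpos _).ne'
    convert! this using 1
    have := hg0 t
    simp only [hg] at this ⊢
    simp
    field_simp
  have hHd := (((hasDerivAt_tan hc).comp t (hθd t)).mul hgd).deriv
  have hsec : 1 / cos (θ t) ^ 2 = 1 + tan (θ t) ^ 2 := by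
    rw [tan_eq_sin_div_cos]; field_simp; linarith [sin_sq_add_cos_sq (θ t)]
  have hHd' : deriv (fun t => tan (θ t) * g t) t =
      -(1 + tan (θ t) ^ 2) * ω + tan (θ t) * (f t * v t / g t) := by
    refine Eq.trans hHd ?_
    rw [hsec]
    have := hg0 t
    simp only [Function.comp]
    field_simp
  have hle : (f t * v t / g t) ^ 2 ≤ v t ^ 2 := by
    rw [div_pow, div_le_iff₀ (by have := hg0 t; positivity), hgsq]
    nlinarith [mul_nonneg (sq_nonneg δ) (sq_nonneg (v t))]
  simp only [hHd']
  nlinarith [sq_nonneg (f t * v t / g t - 2 * ω * tan (θ t))]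

/-- The Kepler Lagrangian at position `q` and velocity `p`, infinite at collisions. -/
def keplerLagrangian (α q p : ℝ) : ENNReal :=
  ENNReal.ofReal ((1/2) * p ^ 2) + (if q = 0 then ⊤ else ENNReal.ofReal (α / |q|))

theorem ofReal_regularized_le_keplerLagrangian {α δ : ℝ} (hα : 0 < α) (hδ : 0 < δ) (q p : ℝ) :
    ENNReal.ofReal ((1/2) * p ^ 2 + α / √(q ^ 2 + δ ^ 2)) ≤ keplerLagrangian α q p := by
  rw [ENNReal.ofReal_add (by positivity) (by positivity), keplerLagrangian]
  gcongr
  split_ifs with hq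
  · exact le_top
  · have : 0 < |q| := abs_pos.2 hq
    refine ENNReal.ofReal_le_ofReal ?_
    gcongr
    exact Real.abs_le_sqrt (by nlinarith [sq_nonneg δ])

/-- Lower bound for the Kepler action of a path starting at the origin, with `π` replaced by a
smaller constant. -/
theorem kepler_action_lower_bound_of_lt {α L k : ℝ} (hα : 0 < α) (hL : 0 < L) (hk : 0 < k)
    (hkπ : k < π) {v : ℝ → ℝ} (hv : Integrable v) (hv2 : Integrable (fun t => v t ^ 2))
    {f : ℝ → ℝ} (hf : ∀ t, f t = ∫ s in (0:ℝ)..t, v s) :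
    ENNReal.ofReal ((3/2) * k ^ ((2:ℝ)/3) * α ^ ((2:ℝ)/3) * L ^ ((1:ℝ)/3)) ≤
      ∫⁻ t in Icc (0:ℝ) L, keplerLagrangian α (f t) (v t) := by
  have hfc : Continuous f := by
    rw [funext hf]; exact intervalIntegral.continuous_primitive (fun a b => hv.intervalIntegrable) 0
  obtain ⟨C, hC⟩ := isCompact_Icc.exists_bound_of_continuousOn (hfc.continuousOn (s := Icc 0 L))
  have hC0 : 0 ≤ C := (norm_nonneg _).trans (hC 0 ⟨le_rfl, hL.le⟩)
  set c := (3/2) * k ^ ((2:ℝ)/3) * α ^ ((2:ℝ)/3) * L ^ ((1:ℝ)/3) with hc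
  set E := k * (C + 1) / L * tan (k / 2) with hE
  have htan : 0 < tan (k / 2) := tan_pos_of_pos_of_lt_pi_div_two (by linarith) (by linarith)
  have key : ∀ δ ∈ Ioo (0:ℝ) 1, ENNReal.ofReal (c - E * δ) ≤
      ∫⁻ t in Icc (0:ℝ) L, keplerLagrangian α (f t) (v t) := by
    rintro δ ⟨hδ, hδ1⟩
    set g : ℝ → ℝ := fun t => √(f t ^ 2 + δ ^ 2) with hg
    have hg0 (t : ℝ) : 0 < g t := Real.sqrt_pos.2 (by positivity)
    have hgc : Continuous g := by fun_prop
    have hgic : Continuous fun t => (g t)⁻¹ := hgc.inv₀ fun t => (hg0 t).ne'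
    have hgle : ∀ t ∈ Icc 0 L, g t ≤ C + 1 := fun t ht => by
      refine Real.sqrt_le_iff.2 ⟨by positivity, ?_⟩
      have h1 := abs_le.1 (hC t ht)
      nlinarith
    have hSlb : L / (C + 1) ≤ ∫ t in (0:ℝ)..L, (g t)⁻¹ := by
      have h := intervalIntegral.integral_mono_on (μ := volume) hL.le
        (f := fun _ => (C + 1)⁻¹) (g := fun t => (g t)⁻¹) (by simp)
        (hgic.intervalIntegrable 0 L) fun t ht => inv_anti₀ (hg0 t) (hgle t ht)
      simpa [div_eq_mul_inv] using h
    set S := ∫ t in (0:ℝ)..L, (g t)⁻¹ with hS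
    have hS0 : 0 < S := lt_of_lt_of_le (by positivity) hSlb
    have hreg := regularized_kepler_action_lower_bound (α := α) (κ := k / 2) hL hδ (by linarith)
      (by linarith) hv hv2 hf hS hS0
    have ham := three_halves_rpow_le_mul_add hα hk hL hS0
    have hkS : k / S ≤ k * (C + 1) / L := by
      rw [div_le_div_iff₀ hS0 hL]
      rw [div_le_iff₀ (by positivity)] at hSlb
      nlinarith
    have hEδ : k / S * (tan (k / 2) * δ) ≤ E * δ := by
      rw [hE, mul_assoc]
      gcongr
    have e1 : 2 * (k / 2 / S) ^ 2 * L = k ^ 2 * L / (2 * S ^ 2) := by field_simp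
    have e2 : 2 * (k / 2 / S) = k / S := by field_simp
    rw [e1, e2] at hreg
    have hcle : c - E * δ ≤ ∫ t in (0:ℝ)..L, ((1/2) * v t ^ 2 + α / g t) := by linarith
    have hgα : Continuous fun t => α / g t := continuous_const.div hgc fun t => (hg0 t).ne'
    have hint : IntegrableOn (fun t => (1/2) * v t ^ 2 + α / g t) (Icc 0 L) :=
      (hv2.const_mul _).integrableOn.add hgα.integrableOn_Icc
    rw [intervalIntegral.integral_of_le hL.le, ← integral_Icc_eq_integral_Ioc] at hcle
    refine (ENNReal.ofReal_le_ofReal hcle).trans ?_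
    rw [ofReal_integral_eq_lintegral_ofReal hint
      (Filter.Eventually.of_forall fun t => by have := hg0 t; simp only [Pi.zero_apply]; positivity)]
    exact lintegral_mono fun t => ofReal_regularized_le_keplerLagrangian hα hδ _ _
  have hlim : Filter.Tendsto (fun δ => ENNReal.ofReal (c - E * δ)) (nhdsWithin 0 (Ioi 0))
      (nhds (ENNReal.ofReal c)) := by
    have : Continuous fun δ => ENNReal.ofReal (c - E * δ) :=
      ENNReal.continuous_ofReal.comp (by fun_prop)
    simpa using (this.tendsto 0).mono_left nhdsWithin_le_nhds
  exact le_of_tendsto hlim (Filter.mem_of_superset (Ioo_mem_nhdsGT one_pos) key)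

/-- Lower bound for the Kepler action of a path starting at the origin. -/
theorem kepler_action_lower_bound_of_start {α L : ℝ} (hα : 0 < α) (hL : 0 ≤ L)
    {v : ℝ → ℝ} (hv : Integrable v) (hv2 : Integrable (fun t => v t ^ 2))
    {f : ℝ → ℝ} (hf : ∀ t, f t = ∫ s in (0:ℝ)..t, v s) :
    ENNReal.ofReal ((3/2) * π ^ ((2:ℝ)/3) * α ^ ((2:ℝ)/3) * L ^ ((1:ℝ)/3)) ≤
      ∫⁻ t in Icc (0:ℝ) L, keplerLagrangian α (f t) (v t) := by
  rcases hL.eq_or_lt with rfl | hL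
  · simp
  have hlim : Filter.Tendsto
      (fun k : ℝ => ENNReal.ofReal ((3/2) * k ^ ((2:ℝ)/3) * α ^ ((2:ℝ)/3) * L ^ ((1:ℝ)/3)))
      (nhdsWithin π (Iio π))
      (nhds (ENNReal.ofReal ((3/2) * π ^ ((2:ℝ)/3) * α ^ ((2:ℝ)/3) * L ^ ((1:ℝ)/3)))) := by
    have : Continuous fun k : ℝ =>
        ENNReal.ofReal ((3/2) * k ^ ((2:ℝ)/3) * α ^ ((2:ℝ)/3) * L ^ ((1:ℝ)/3)) := by
      have := Real.continuous_rpow_const (q := (2:ℝ)/3) (by norm_num)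
      exact ENNReal.continuous_ofReal.comp (by fun_prop)
    exact (this.tendsto π).mono_left nhdsWithin_le_nhds
  exact le_of_tendsto hlim (Filter.mem_of_superset (Ioo_mem_nhdsLT pi_pos)
    fun k hk => kepler_action_lower_bound_of_lt hα hL hk.1 hk.2 hv hv2 hf)

/-- Lower bound for the Kepler action of an H¹ path `ξ` on `[0, T₀]` vanishing
somewhere: `∫ (1/2) ξ'² + α/|ξ| ≥ (3/2) π^(2/3) α^(2/3) T₀^(1/3)`.  The potential
term is interpreted as `+∞` where `ξ` vanishes, so the action may be infinite. -/
theorem kepler_action_lower_bound (α T₀ : ℝ) (hα : 0 < α) (hT : 0 < T₀)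
    (ξ ξ' : ℝ → ℝ)
    (hac : ∀ t ∈ Icc 0 T₀, ξ t = ξ 0 + ∫ s in (0:ℝ)..t, ξ' s)
    (hint : IntervalIntegrable ξ' volume 0 T₀)
    (hL2 : IntervalIntegrable (fun t => ξ' t ^ 2) volume 0 T₀)
    (t₀ : ℝ) (ht₀ : t₀ ∈ Icc 0 T₀) (hzero : ξ t₀ = 0) :
    ENNReal.ofReal ((3/2) * π ^ ((2:ℝ)/3) * α ^ ((2:ℝ)/3) * T₀ ^ ((1:ℝ)/3)) ≤
      ∫⁻ t in Icc (0:ℝ) T₀,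
        (ENNReal.ofReal ((1/2) * ξ' t ^ 2) +
          (if ξ t = 0 then ⊤ else ENNReal.ofReal (α / |ξ t|))) := by
  set η : ℝ → ℝ := (Icc 0 T₀).indicator ξ' with hη
  have hη1 : Integrable η :=
    ((intervalIntegrable_iff_integrableOn_Icc_of_le hT.le).1 hint).integrable_indicator
      measurableSet_Icc
  have hη2 : Integrable fun t => η t ^ 2 := by
    refine (((intervalIntegrable_iff_integrableOn_Icc_of_le hT.le).1 hL2).integrable_indicator
      measurableSet_Icc).congr (Filter.Eventually.of_forall fun t => ?_)
    by_cases ht : t ∈ Icc 0 T₀ <;> simp [hη, ht]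
  have hηeq : ∀ t ∈ Icc 0 T₀, η t = ξ' t := fun t ht => by simp [hη, ht]
  have hξ : ∀ t ∈ Icc 0 T₀, ξ t = ∫ s in t₀..t, η s := by
    intro t ht
    have hcongr : ∀ r ∈ Icc 0 T₀, ∫ s in (0:ℝ)..r, η s = ∫ s in (0:ℝ)..r, ξ' s := by
      intro r hr
      refine intervalIntegral.integral_congr fun s hs => hηeq s ?_
      rw [uIcc_of_le hr.1] at hs
      exact ⟨hs.1, hs.2.trans hr.2⟩
    rw [← intervalIntegral.integral_interval_sub_left (a := 0) hη1.intervalIntegrable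
      hη1.intervalIntegrable, hcongr t ht, hcongr t₀ ht₀]
    have h1 := hac t ht
    have h2 := hac t₀ ht₀
    linarith
  have hright := kepler_action_lower_bound_of_start hα (sub_nonneg.2 ht₀.2)
    (hη1.comp_add_left t₀) (hη2.comp_add_left t₀) (fun t => rfl)
  have hleft := kepler_action_lower_bound_of_start hα ht₀.1
    (hη1.comp_sub_left t₀).neg (by simpa using hη2.comp_sub_left t₀) (fun t => rfl)
  have eright : ∫⁻ t in Icc 0 (T₀ - t₀), keplerLagrangian α (∫ s in (0:ℝ)..t, η (t₀ + s))
      (η (t₀ + t)) = ∫⁻ t in Icc t₀ T₀, keplerLagrangian α (ξ t) (ξ' t) := by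
    rw [← (measurePreserving_add_left volume t₀).setLIntegral_comp_preimage_emb
      (measurableEmbedding_addLeft t₀) _ (Icc t₀ T₀)]
    rw [preimage_const_add_Icc, sub_self]
    refine setLIntegral_congr_fun measurableSet_Icc fun t ht => ?_
    have hm : t₀ + t ∈ Icc 0 T₀ := ⟨by linarith [ht₀.1, ht.1], by linarith [ht.2]⟩
    rw [hηeq _ hm, hξ _ hm, intervalIntegral.integral_comp_add_left, add_zero]
  have eleft : ∫⁻ t in Icc 0 t₀, keplerLagrangian α (∫ s in (0:ℝ)..t, (-fun s => η (t₀ - s)) s)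
      ((-fun s => η (t₀ - s)) t) = ∫⁻ t in Icc 0 t₀, keplerLagrangian α (ξ t) (ξ' t) := by
    rw [← (Measure.measurePreserving_sub_left volume t₀).setLIntegral_comp_preimage_emb
      (measurableEmbedding_subLeft t₀) (fun t => keplerLagrangian α (ξ t) (ξ' t))]
    rw [preimage_const_sub_Icc, sub_self, sub_zero]
    refine setLIntegral_congr_fun measurableSet_Icc fun t ht => ?_
    have hm : t₀ - t ∈ Icc 0 T₀ := ⟨by linarith [ht.2], by linarith [ht₀.2, ht.1]⟩
    simp only [Pi.neg_apply]
    rw [hηeq _ hm, hξ _ hm, intervalIntegral.integral_neg,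
      intervalIntegral.integral_comp_sub_left, sub_zero, intervalIntegral.integral_symm, neg_neg]
    simp [keplerLagrangian]
  rw [eright] at hright
  rw [eleft] at hleft
  have hsplit : ∫⁻ t in Icc 0 T₀, keplerLagrangian α (ξ t) (ξ' t) =
      (∫⁻ t in Icc 0 t₀, keplerLagrangian α (ξ t) (ξ' t)) +
        ∫⁻ t in Icc t₀ T₀, keplerLagrangian α (ξ t) (ξ' t) := by
    rw [setLIntegral_congr (s := Icc t₀ T₀) Ioc_ae_eq_Icc.symm,
      ← lintegral_union measurableSet_Ioc (Set.disjoint_left.2 fun x h1 h2 => h2.1.not_ge h1.2),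
      Icc_union_Ioc_eq_Icc ht₀.1 ht₀.2]
  change _ ≤ ∫⁻ t in Icc 0 T₀, keplerLagrangian α (ξ t) (ξ' t)
  rw [hsplit]
  refine le_trans ?_ (add_le_add hleft hright)
  have hr := sub_nonneg.2 ht₀.2
  have hl := ht₀.1
  rw [← ENNReal.ofReal_add (by positivity) (by positivity), ← mul_add]
  refine ENNReal.ofReal_le_ofReal (mul_le_mul_of_nonneg_left ?_ (by positivity))
  simpa using Real.rpow_add_le_add_rpow hl hr (p := (1:ℝ)/3) (by norm_num) (by norm_num)

end
end

section
/- Let r : [0, π/4] → ℝ be an absolutely continuous nonnegative function with square-integrable derivative such that r(t₀) = 0 for some t₀ ∈ [0, π/4]. Then ∫₀^{π/4} ( (1/2) r'(t)² + (4+√2)/r(t) ) dt ≥ 2^{−4/3} · 3 · (1+2√2)^{2/3} · π, and moreover 2^{−4/3} · 3 · (1+2√2)^{2/3} · π > 9 (the integrand being +∞ where r vanishes). -/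
open Real Set MeasureTheory

noncomputable section

theorem LipschitzOnWith.comp_absolutelyContinuousOnInterval {g f : ℝ → ℝ} {s : Set ℝ}
    {K : NNReal} {a b : ℝ} (hg : LipschitzOnWith K g s) (hf : AbsolutelyContinuousOnInterval f a b)
    (hs : MapsTo f (uIcc a b) s) : AbsolutelyContinuousOnInterval (g ∘ f) a b := by
  rw [absolutelyContinuousOnInterval_iff] at hf ⊢
  intro ε hε
  have hK : (0 : ℝ) < K + 1 := by positivity
  obtain ⟨δ, hδ, h⟩ := hf (ε / (K + 1)) (by positivity)
  refine ⟨δ, hδ, fun E hE hlt => ?_⟩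
  have h1 := h E hE hlt
  have h0 : 0 ≤ ∑ i ∈ Finset.range E.1, dist (f (E.2 i).1) (f (E.2 i).2) :=
    Finset.sum_nonneg fun _ _ => dist_nonneg
  have h2 : ∑ i ∈ Finset.range E.1, dist ((g ∘ f) (E.2 i).1) ((g ∘ f) (E.2 i).2) ≤
      K * ∑ i ∈ Finset.range E.1, dist (f (E.2 i).1) (f (E.2 i).2) := by
    rw [Finset.mul_sum]
    refine Finset.sum_le_sum fun i hi => ?_
    exact hg.dist_le_mul _ (hs (hE.1 i hi).1) _ (hs (hE.1 i hi).2)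
  rw [lt_div_iff₀ hK] at h1
  nlinarith

theorem Real.exists_lipschitzOnWith_tan {M : ℝ} (hM : M < π / 2) :
    ∃ K, LipschitzOnWith K tan (Icc (-M) M) := by
  have hcos : ∀ x ∈ Icc (-M) M, 0 < cos x := fun x hx =>
    cos_pos_of_mem_Ioo ⟨by linarith [hx.1], by linarith [hx.2]⟩
  have hcont : ContinuousOn (fun x => 1 / cos x ^ 2) (Icc (-M) M) :=
    continuousOn_const.div (by fun_prop) fun x hx => (pow_pos (hcos x hx) 2).ne'
  obtain ⟨C, hC⟩ := isCompact_Icc.exists_bound_of_continuousOn hcont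
  refine ⟨C.toNNReal, (convex_Icc (-M) M).lipschitzOnWith_of_nnnorm_hasDerivWithin_le
    (fun x hx => (hasDerivAt_tan (hcos x hx).ne').hasDerivWithinAt) fun x hx => ?_⟩
  exact NNReal.le_toNNReal_of_coe_le (hC x hx)

/-- Calibration of the kinetic energy by the momentum field `2 k tan (k w)`, where `w` is a
primitive of `-1 / r`. -/
theorem two_mul_sq_mul_le_integral_half_sq {r r' w : ℝ → ℝ} {a b k M : ℝ} (hab : a ≤ b)
    (hr : AbsolutelyContinuousOnInterval r a b)
    (hr' : ∀ᵐ x, x ∈ uIcc a b → HasDerivAt r (r' x) x)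
    (hL2 : IntervalIntegrable (fun t => r' t ^ 2) volume a b)
    (hne : ∀ᵐ x, x ∈ uIcc a b → r x ≠ 0)
    (hw : AbsolutelyContinuousOnInterval w a b)
    (hw' : ∀ᵐ x, x ∈ uIcc a b → HasDerivAt w (-(r x)⁻¹) x)
    (hM : M < π / 2) (hwM : ∀ x ∈ uIcc a b, k * w x ∈ Icc (-M) M)
    (ha : r a = 0 ∨ w a = 0) (hb : r b = 0 ∨ w b = 0) :
    2 * k ^ 2 * (b - a) ≤ ∫ t in a..b, 1 / 2 * r' t ^ 2 := by
  obtain ⟨K, hK⟩ := exists_lipschitzOnWith_tan hM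
  have hF := ((hK.comp_absolutelyContinuousOnInterval (hw.const_mul k) hwM).fun_mul hr).const_mul
    (2 * k)
  have hFTC := hF.integral_deriv_eq_sub
  have hFa : tan (k * w a) * r a = 0 := by rcases ha with h | h <;> simp [h]
  have hFb : tan (k * w b) * r b = 0 := by rcases hb with h | h <;> simp [h]
  simp only [Function.comp_apply, hFa, hFb, mul_zero, sub_zero] at hFTC
  have hint : IntervalIntegrable (fun t => 1 / 2 * r' t ^ 2) volume a b := hL2.const_mul _
  have hmono := intervalIntegral.integral_mono_ae_restrict hab hF.intervalIntegrable_deriv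
    (hint.sub (intervalIntegrable_const (c := 2 * k ^ 2))) ?_
  · simp only [Function.comp_apply] at hmono
    rw [hFTC, intervalIntegral.integral_sub hint intervalIntegrable_const,
      intervalIntegral.integral_const, smul_eq_mul] at hmono
    linarith
  · rw [Filter.EventuallyLE, ae_restrict_iff' measurableSet_Icc]
    filter_upwards [hr', hne, hw'] with x h1 h2 h3 hx
    rw [← uIcc_of_le hab] at hx
    have hcos : cos (k * w x) ≠ 0 :=
      (cos_pos_of_mem_Ioo ⟨by linarith [(hwM x hx).1], by linarith [(hwM x hx).2]⟩).ne'
    have hd := ((((hasDerivAt_tan hcos).comp x ((h3 hx).const_mul k)).mul (h1 hx)).const_mul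
      (2 * k)).deriv
    have hd' : deriv (fun x => 2 * k * ((tan ∘ fun x => k * w x) x * r x)) x =
      2 * k * (tan (k * w x) * r' x - k * (1 + tan (k * w x) ^ 2)) := by
      refine hd.trans ?_
      rw [one_div, ← inv_one_add_tan_sq hcos, inv_inv]
      have := h2 hx
      simp only [Function.comp_apply]
      field_simp
      ring
    simp only [hd']
    nlinarith [sq_nonneg (r' x - 2 * k * tan (k * w x))]

/-- The Wirtinger-type bound on the kinetic energy of a path, in terms of the
integral of `1 / r`, on an interval with a collision at one end. -/
theorem two_mul_sq_mul_le_integral_half_sq_of_collision {r r' : ℝ → ℝ} {a b c k : ℝ} (hab : a ≤ b)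
    (hr : AbsolutelyContinuousOnInterval r a b)
    (hr' : ∀ᵐ x, x ∈ uIcc a b → HasDerivAt r (r' x) x)
    (hL2 : IntervalIntegrable (fun t => r' t ^ 2) volume a b)
    (hnonneg : ∀ x ∈ uIcc a b, 0 ≤ r x)
    (hne : ∀ᵐ x, x ∈ uIcc a b → r x ≠ 0)
    (hinv : IntervalIntegrable (fun t => (r t)⁻¹) volume a b)
    (hk : 0 ≤ k) (hkS : k * ∫ t in a..b, (r t)⁻¹ < π / 2) (hc : c ∈ uIcc a b)
    (ha : r a = 0 ∨ a = c) (hb : r b = 0 ∨ b = c) :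
    2 * k ^ 2 * (b - a) ≤ ∫ t in a..b, 1 / 2 * r' t ^ 2 := by
  refine two_mul_sq_mul_le_integral_half_sq (w := fun x => -∫ t in c..x, (r t)⁻¹) hab hr hr' hL2 hne
    (hinv.absolutelyContinuousOnInterval_intervalIntegral hc).neg ?_ hkS ?_
    (ha.imp_right ?_) (hb.imp_right ?_)
  · filter_upwards [hinv.ae_hasDerivAt_integral] with x hx hxm
    exact (hx hxm c hc).neg
  · intro x hx
    rw [mem_Icc, ← abs_le, abs_mul, abs_neg, abs_of_nonneg hk]
    have hS : 0 ≤ ∫ t in a..b, (r t)⁻¹ := intervalIntegral.integral_nonneg hab fun t ht =>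
      inv_nonneg.2 (hnonneg t (Icc_subset_uIcc ht))
    rw [← abs_of_nonneg hS]
    refine mul_le_mul_of_nonneg_left (intervalIntegral.abs_integral_mono_interval ?_ ?_ hinv) hk
    · grind [uIoc, uIcc]
    · refine (ae_restrict_iff' measurableSet_uIoc).2 (.of_forall fun t ht => ?_)
      exact inv_nonneg.2 (hnonneg t (uIoc_subset_uIcc ht))
  · rintro rfl; simp
  · rintro rfl; simp

theorem three_mul_mul_sq_le {α A y x : ℝ} (hα : 0 < α) (hy : 0 ≤ y) (hx : 0 < x)
    (h : y ^ 3 = A * α ^ 2 / 4) : 3 * y ≤ A / x ^ 2 + α * x := by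
  have hA : A = 4 * y ^ 3 / α ^ 2 := by field_simp; linarith
  rw [hA, ← sub_nonneg]
  have : 4 * y ^ 3 / α ^ 2 / x ^ 2 + α * x - 3 * y =
      (α * x - 2 * y) ^ 2 * (α * x + y) / (α * x) ^ 2 := by
    field_simp
    ring
  rw [this]
  positivity
/-- Real-valued form of the Kepler bound on the action of a path with a collision. -/
theorem three_mul_le_integral_add_of_collision {r r' : ℝ → ℝ} {T t₀ α y : ℝ}
    (hα : 0 < α) (hy : 0 ≤ y) (hyT : y ^ 3 = π ^ 2 * T / 2 * α ^ 2 / 4)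
    (hr : AbsolutelyContinuousOnInterval r 0 T)
    (hr' : ∀ᵐ x, x ∈ uIcc 0 T → HasDerivAt r (r' x) x)
    (hL2 : IntervalIntegrable (fun t => r' t ^ 2) volume 0 T)
    (hnonneg : ∀ x ∈ uIcc 0 T, 0 ≤ r x)
    (hne : ∀ᵐ x, x ∈ uIcc 0 T → r x ≠ 0)
    (hinv : IntervalIntegrable (fun t => (r t)⁻¹) volume 0 T)
    (ht₀ : t₀ ∈ Icc 0 T) (hzero : r t₀ = 0) :
    3 * y ≤ (∫ t in (0 : ℝ)..T, 1 / 2 * r' t ^ 2) + α * ∫ t in (0 : ℝ)..T, (r t)⁻¹ := by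
  have hT : 0 ≤ T := ht₀.1.trans ht₀.2
  set S := ∫ t in (0 : ℝ)..T, (r t)⁻¹ with hSdef
  have hinvnn : ∀ x ∈ uIcc 0 T, 0 ≤ (r x)⁻¹ := fun x hx => inv_nonneg.2 (hnonneg x hx)
  have hS : 0 ≤ S := intervalIntegral.integral_nonneg hT fun t ht =>
    hinvnn t (Icc_subset_uIcc ht)
  have hsub₁ : uIcc 0 t₀ ⊆ uIcc 0 T := by grind [uIcc]
  have hsub₂ : uIcc t₀ T ⊆ uIcc 0 T := by grind [uIcc]
  have hinv₁ := hinv.mono_set hsub₁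
  have hinv₂ := hinv.mono_set hsub₂
  have hsplit : (∫ t in (0 : ℝ)..t₀, (r t)⁻¹) + ∫ t in t₀..T, (r t)⁻¹ = S :=
    intervalIntegral.integral_add_adjacent_intervals hinv₁ hinv₂
  have hS₁ : 0 ≤ ∫ t in (0 : ℝ)..t₀, (r t)⁻¹ := intervalIntegral.integral_nonneg ht₀.1 fun t ht =>
    hinvnn t (hsub₁ (Icc_subset_uIcc ht))
  have hS₂ : 0 ≤ ∫ t in t₀..T, (r t)⁻¹ := intervalIntegral.integral_nonneg ht₀.2 fun t ht =>
    hinvnn t (hsub₂ (Icc_subset_uIcc ht))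
  have hkin : ∀ k, 0 ≤ k → k * S < π / 2 →
      2 * k ^ 2 * T ≤ ∫ t in (0 : ℝ)..T, 1 / 2 * r' t ^ 2 := by
    intro k hk hkS
    have hL : ∀ {a b}, uIcc a b ⊆ uIcc 0 T →
        IntervalIntegrable (fun t => r' t ^ 2) volume a b := fun h => hL2.mono_set h
    have h₁ := two_mul_sq_mul_le_integral_half_sq_of_collision (c := 0) ht₀.1 (hr.mono hsub₁)
      (hr'.mono fun x hx h => hx (hsub₁ h)) (hL hsub₁) (fun x hx => hnonneg x (hsub₁ hx))
      (hne.mono fun x hx h => hx (hsub₁ h)) hinv₁ hk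
      (by nlinarith) left_mem_uIcc (.inr rfl) (.inl hzero)
    have h₂ := two_mul_sq_mul_le_integral_half_sq_of_collision (c := T) ht₀.2 (hr.mono hsub₂)
      (hr'.mono fun x hx h => hx (hsub₂ h)) (hL hsub₂) (fun x hx => hnonneg x (hsub₂ hx))
      (hne.mono fun x hx h => hx (hsub₂ h)) hinv₂ hk
      (by nlinarith) right_mem_uIcc (.inl hzero) (.inr rfl)
    rw [← intervalIntegral.integral_add_adjacent_intervals ((hL hsub₁).const_mul _)
      ((hL hsub₂).const_mul _)]
    linarith
  refine le_of_forall_pos_le_add fun ε hε => ?_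
  have hδ : 0 < ε / α := by positivity
  have hx : 0 < S + ε / α := by positivity
  have h := hkin (π / (2 * (S + ε / α))) (by positivity) (by
    rw [div_mul_eq_mul_div, div_lt_div_iff₀ (by positivity) two_pos]
    nlinarith [pi_pos])
  have h' := three_mul_mul_sq_le hα hy hx hyT
  have e1 : 2 * (π / (2 * (S + ε / α))) ^ 2 * T = π ^ 2 * T / 2 / (S + ε / α) ^ 2 := by
    field_simp
  have e2 : α * (S + ε / α) = α * S + ε := by field_simp
  linarith

/-- Kepler bound on the action of a path with a collision, as an extended nonnegative real. -/
theorem ofReal_three_mul_le_lintegral_of_collision {r r' : ℝ → ℝ} {T t₀ α y : ℝ}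
    (hα : 0 < α) (hy : 0 ≤ y) (hyT : y ^ 3 = π ^ 2 * T / 2 * α ^ 2 / 4)
    (hr : AbsolutelyContinuousOnInterval r 0 T)
    (hr' : ∀ᵐ x, x ∈ uIcc 0 T → HasDerivAt r (r' x) x)
    (hL2 : IntervalIntegrable (fun t => r' t ^ 2) volume 0 T)
    (hnonneg : ∀ x ∈ uIcc 0 T, 0 ≤ r x)
    (ht₀ : t₀ ∈ Icc 0 T) (hzero : r t₀ = 0) :
    ENNReal.ofReal (3 * y) ≤ ∫⁻ t in Icc 0 T, (ENNReal.ofReal ((1 / 2) * r' t ^ 2) +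
      (if r t = 0 then ⊤ else ENNReal.ofReal (α / r t))) := by
  have hT : 0 ≤ T := ht₀.1.trans ht₀.2
  have hIcc : uIcc 0 T = Icc 0 T := uIcc_of_le hT
  have hmeas : AEMeasurable r (volume.restrict (Icc 0 T)) :=
    (hIcc ▸ hr.continuousOn).aemeasurable measurableSet_Icc
  have hkin : IntegrableOn (fun t => 1 / 2 * r' t ^ 2) (Icc 0 T) :=
    (intervalIntegrable_iff_integrableOn_Icc_of_le hT).1 (hL2.const_mul _)
  rw [lintegral_add_left' hkin.aemeasurable.ennreal_ofReal]
  by_cases htop : ∫⁻ t in Icc 0 T, (if r t = 0 then ⊤ else ENNReal.ofReal (α / r t)) = ⊤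
  · simp [htop]
  have hpot_meas : AEMeasurable (fun t => if r t = 0 then ⊤ else ENNReal.ofReal (α / r t))
      (volume.restrict (Icc 0 T)) := by
    have : Measurable fun x : ℝ => if x = 0 then ⊤ else ENNReal.ofReal (α / x) :=
      Measurable.ite (measurableSet_singleton 0) measurable_const (by fun_prop)
    exact this.comp_aemeasurable hmeas
  have hne : ∀ᵐ t, t ∈ uIcc 0 T → r t ≠ 0 := by
    rw [hIcc, ← ae_restrict_iff' measurableSet_Icc]
    filter_upwards [ae_lt_top' hpot_meas htop] with t ht h0
    simp [h0] at ht
  have hle : ∫⁻ t in Icc 0 T, ENNReal.ofReal (α * (r t)⁻¹) ≤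
      ∫⁻ t in Icc 0 T, (if r t = 0 then ⊤ else ENNReal.ofReal (α / r t)) := by
    refine lintegral_mono fun t => ?_
    dsimp only
    split_ifs
    · exact le_top
    · rw [div_eq_mul_inv]
  have hpot_nonneg : 0 ≤ᵐ[volume.restrict (Icc 0 T)] fun t => α * (r t)⁻¹ :=
    (ae_restrict_iff' measurableSet_Icc).2 (.of_forall fun t ht =>
      mul_nonneg hα.le (inv_nonneg.2 (hnonneg t (hIcc ▸ ht))))
  have hpot : IntegrableOn (fun t => α * (r t)⁻¹) (Icc 0 T) :=
    ⟨(hmeas.inv.const_mul α).aestronglyMeasurable,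
      (hasFiniteIntegral_iff_ofReal hpot_nonneg).2 (hle.trans_lt (lt_top_iff_ne_top.2 htop))⟩
  have hinv : IntervalIntegrable (fun t => (r t)⁻¹) volume 0 T := by
    have := ((intervalIntegrable_iff_integrableOn_Icc_of_le hT).2 hpot).const_mul α⁻¹
    simpa [hα.ne'] using this
  have hmain := three_mul_le_integral_add_of_collision hα hy hyT hr hr' hL2 hnonneg hne hinv
    ht₀ hzero
  rw [← intervalIntegral.integral_const_mul, intervalIntegral.integral_of_le hT,
    intervalIntegral.integral_of_le hT, ← integral_Icc_eq_integral_Ioc,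
    ← integral_Icc_eq_integral_Ioc] at hmain
  calc ENNReal.ofReal (3 * y)
      ≤ ENNReal.ofReal (∫ t in Icc 0 T, 1 / 2 * r' t ^ 2) +
        ENNReal.ofReal (∫ t in Icc 0 T, α * (r t)⁻¹) :=
        (ENNReal.ofReal_le_ofReal hmain).trans ENNReal.ofReal_add_le
    _ ≤ _ := by
        rw [ofReal_integral_eq_lintegral_ofReal hkin (.of_forall fun t => by positivity),
          ofReal_integral_eq_lintegral_ofReal hpot hpot_nonneg]
        gcongr

theorem kepler_constant_cube :
    ((2:ℝ) ^ (-(4:ℝ)/3) * (1 + 2 * √2) ^ ((2:ℝ)/3)) ^ 3 = (9 + 4 * √2) / 16 := by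
  have h2 : √2 ^ 2 = 2 := sq_sqrt two_pos.le
  have hs : 0 ≤ 1 + 2 * √2 := by positivity
  rw [mul_pow, ← rpow_mul_natCast two_pos.le, ← rpow_mul_natCast hs]
  rw [show -(4:ℝ) / 3 * (3 : ℕ) = ((-4 : ℤ) : ℝ) by norm_num,
    show (2:ℝ) / 3 * (3 : ℕ) = ((2 : ℕ) : ℝ) by norm_num, rpow_intCast, rpow_natCast]
  norm_num
  linarith

/-- Lower bound for the radial action of a nonnegative H¹ path on `[0, π/4]`
vanishing somewhere, with Kepler constant `α = 4 + √2`: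
`∫ (1/2) r'² + (4+√2)/r ≥ 2^(-4/3) · 3 · (1+2√2)^(2/3) · π`, and this bound
exceeds `9`.  The potential term is interpreted as `+∞` where `r` vanishes. -/
theorem total_collision_action_lower_bound (r r' : ℝ → ℝ)
    (hnonneg : ∀ t ∈ Icc (0:ℝ) (π/4), 0 ≤ r t)
    (hac : ∀ t ∈ Icc (0:ℝ) (π/4), r t = r 0 + ∫ s in (0:ℝ)..t, r' s)
    (hint : IntervalIntegrable r' volume 0 (π/4))
    (hL2 : IntervalIntegrable (fun t => r' t ^ 2) volume 0 (π/4))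
    (t₀ : ℝ) (ht₀ : t₀ ∈ Icc (0:ℝ) (π/4)) (hzero : r t₀ = 0) :
    ENNReal.ofReal ((2:ℝ) ^ (-(4:ℝ)/3) * 3 * (1 + 2 * Real.sqrt 2) ^ ((2:ℝ)/3) * π) ≤
      (∫⁻ t in Icc (0:ℝ) (π/4),
        (ENNReal.ofReal ((1/2) * r' t ^ 2) +
          (if r t = 0 then ⊤ else ENNReal.ofReal ((4 + Real.sqrt 2) / r t)))) ∧
    (9:ℝ) < (2:ℝ) ^ (-(4:ℝ)/3) * 3 * (1 + 2 * Real.sqrt 2) ^ ((2:ℝ)/3) * π := by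
  set β := (2:ℝ) ^ (-(4:ℝ)/3) * (1 + 2 * √2) ^ ((2:ℝ)/3) with hβdef
  have hβ : 0 ≤ β := by positivity
  have hβ3 : β ^ 3 = (9 + 4 * √2) / 16 := kepler_constant_cube
  have hs : √2 ^ 2 = 2 := sq_sqrt two_pos.le
  have hT : (0 : ℝ) ≤ π / 4 := by positivity
  have hIcc : uIcc 0 (π / 4) = Icc 0 (π / 4) := uIcc_of_le hT
  rw [show (2:ℝ) ^ (-(4:ℝ)/3) * 3 * (1 + 2 * √2) ^ ((2:ℝ)/3) * π = 3 * (π * β) by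
    rw [hβdef]; ring]
  constructor
  · have key := ofReal_three_mul_le_lintegral_of_collision (α := 4 + √2) (y := π * β)
      (r := fun t => r 0 + ∫ s in (0 : ℝ)..t, r' s) (r' := r') (by positivity) (by positivity)
      (by rw [mul_pow, hβ3]; linear_combination (-π ^ 3 / 32) * hs)
      (((LipschitzWith.const (r 0)).lipschitzOnWith (s := _)).absolutelyContinuousOnInterval.add
        (hint.absolutelyContinuousOnInterval_intervalIntegral left_mem_uIcc))
      (by
        filter_upwards [hint.ae_hasDerivAt_integral] with x hx hxm
        exact (hx hxm 0 left_mem_uIcc).const_add _)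
      hL2 (fun x hx => hac x (hIcc ▸ hx) ▸ hnonneg x (hIcc ▸ hx)) ht₀ (hac t₀ ht₀ ▸ hzero)
    refine key.trans_eq (setLIntegral_congr_fun measurableSet_Icc fun t ht => ?_)
    simp only [← hac t ht]
  · have hs1 : (1.4 : ℝ) < √2 := lt_sqrt_of_sq_lt (by norm_num)
    have hβ' : (0.956 : ℝ) < β := lt_of_pow_lt_pow_left₀ 3 hβ (by rw [hβ3]; norm_num; linarith)
    nlinarith [pi_gt_d2]

end
end

section
/- For q₁ = (x₁, y₁), q₂ = (x₂, y₂) ∈ ℝ² with q₁ ≠ 0, q₂ ≠ 0, q₁ ≠ q₂, q₁ ≠ −q₂, define the reflected configuration q₁* = (|x₁|, −|y₁|) (lying in the fourth quadrant) and q₂* = (|x₂|, |y₂|) (lying in the first quadrant). Then |q₁*| = |q₁|, |q₂*| = |q₂|, and the potential U(q₁, q₂) = 1/|q₁−q₂| + 1/|q₁+q₂| + 1/(4|q₁|) + 1/(4|q₂|) satisfies U(q₁, q₂) ≥ U(q₁*, q₂*). Moreover the inequality is strict whenever q₁ and q₂ lie in the same open quadrant, i.e. whenever x₁x₂ > 0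 and y₁y₂ > 0. -/
open Real Set

noncomputable section

/-- The plane with the Euclidean norm. -/
abbrev E2 : Type := EuclideanSpace ℝ (Fin 2)

/-- The reduced potential of the parallelogram configuration `(q₁, q₂, -q₁, -q₂)`. -/
def redU (q₁ q₂ : E2) : ℝ :=
  1 / ‖q₁ - q₂‖ + 1 / ‖q₁ + q₂‖ + 1 / (4 * ‖q₁‖) + 1 / (4 * ‖q₂‖)

theorem sq_one_div_add_one_div {a b : ℝ} (ha : 0 < a) (hb : 0 < b) :
    (1 / a + 1 / b) ^ 2 = (a ^ 2 + b ^ 2) * (1 / (a * b)) ^ 2 + 2 * (1 / (a * b)) := by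
  field_simp
  ring

/-- Among pairs of positive reals with a fixed sum of squares, the sum of the reciprocals is
antitone in the product. -/
theorem one_div_add_one_div_le {a b c d : ℝ} (ha : 0 < a) (hb : 0 < b) (hc : 0 < c) (hd : 0 < d)
    (hsum : a ^ 2 + b ^ 2 = c ^ 2 + d ^ 2) (hmul : a * b ≤ c * d) :
    1 / c + 1 / d ≤ 1 / a + 1 / b := by
  refine le_of_pow_le_pow_left₀ two_ne_zero (by positivity) ?_
  rw [sq_one_div_add_one_div ha hb, sq_one_div_add_one_div hc hd, hsum]
  have : 0 < a * b := by positivity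
  gcongr

/-- Among pairs of positive reals with a fixed sum of squares, the sum of the reciprocals is
strictly antitone in the product. -/
theorem one_div_add_one_div_lt {a b c d : ℝ} (ha : 0 < a) (hb : 0 < b) (hc : 0 < c) (hd : 0 < d)
    (hsum : a ^ 2 + b ^ 2 = c ^ 2 + d ^ 2) (hmul : a * b < c * d) :
    1 / c + 1 / d < 1 / a + 1 / b := by
  refine lt_of_pow_lt_pow_left₀ 2 (by positivity) ?_
  rw [sq_one_div_add_one_div ha hb, sq_one_div_add_one_div hc hd, hsum]
  have : 0 < a * b := by positivity
  gcongr

theorem E2.norm_sq (q : E2) : ‖q‖ ^ 2 = q 0 ^ 2 + q 1 ^ 2 := by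
  simp [EuclideanSpace.norm_sq_eq]

/-- Reflecting `q₁` into the closed fourth quadrant and `q₂` into the closed
first quadrant preserves the norms and decreases the reduced potential of the
parallelogram configuration, strictly so if `q₁` and `q₂` lie in the same open
quadrant. -/
theorem reflection_decreases_potential (q₁ q₂ q₁s q₂s : E2)
    (h1 : q₁ ≠ 0) (h2 : q₂ ≠ 0) (h3 : q₁ ≠ q₂) (h4 : q₁ ≠ -q₂)
    (hq₁s : q₁s = ![|q₁ 0|, -|q₁ 1|])
    (hq₂s : q₂s = ![|q₂ 0|, |q₂ 1|]) :
    ‖q₁s‖ = ‖q₁‖ ∧ ‖q₂s‖ = ‖q₂‖ ∧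
    redU q₁s q₂s ≤ redU q₁ q₂ ∧
    (0 < q₁ 0 * q₂ 0 → 0 < q₁ 1 * q₂ 1 → redU q₁s q₂s < redU q₁ q₂) := by
  have e10 : q₁s 0 = |q₁ 0| := by simp [hq₁s]
  have e11 : q₁s 1 = -|q₁ 1| := by simp [hq₁s]
  have e20 : q₂s 0 = |q₂ 0| := by simp [hq₂s]
  have e21 : q₂s 1 = |q₂ 1| := by simp [hq₂s]
  have n1 : ‖q₁s‖ = ‖q₁‖ := by
    rw [← sq_eq_sq₀ (norm_nonneg _) (norm_nonneg _), E2.norm_sq, E2.norm_sq, e10, e11]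
    simp
  have n2 : ‖q₂s‖ = ‖q₂‖ := by
    rw [← sq_eq_sq₀ (norm_nonneg _) (norm_nonneg _), E2.norm_sq, E2.norm_sq, e20, e21]
    simp
  have ha : 0 < ‖q₁ - q₂‖ := norm_pos_iff.2 (sub_ne_zero.2 h3)
  have hb : 0 < ‖q₁ + q₂‖ := norm_pos_iff.2 fun h => h4 (eq_neg_of_add_eq_zero_left h)
  have hsum : ‖q₁ - q₂‖ ^ 2 + ‖q₁ + q₂‖ ^ 2 = ‖q₁s - q₂s‖ ^ 2 + ‖q₁s + q₂s‖ ^ 2 := by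
    simp only [E2.norm_sq, PiLp.sub_apply, PiLp.add_apply, e10, e11, e20, e21]
    linear_combination (-2) * (sq_abs (q₁ 0) + sq_abs (q₁ 1) + sq_abs (q₂ 0) + sq_abs (q₂ 1))
  have hprod : (‖q₁s - q₂s‖ * ‖q₁s + q₂s‖) ^ 2 = (‖q₁ - q₂‖ * ‖q₁ + q₂‖) ^ 2
      + 8 * (q₁ 0 * q₂ 0 * (q₁ 1 * q₂ 1) + |q₁ 0 * q₂ 0 * (q₁ 1 * q₂ 1)|) := by
    simp only [mul_pow, E2.norm_sq, PiLp.sub_apply, PiLp.add_apply, e10, e11, e20, e21, abs_mul]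
    have s1 := sq_abs (q₁ 0)
    have s2 := sq_abs (q₁ 1)
    have s3 := sq_abs (q₂ 0)
    have s4 := sq_abs (q₂ 1)
    grind
  have hle : ‖q₁ - q₂‖ * ‖q₁ + q₂‖ ≤ ‖q₁s - q₂s‖ * ‖q₁s + q₂s‖ := by
    refine le_of_pow_le_pow_left₀ two_ne_zero (by positivity) ?_
    linarith [neg_abs_le (q₁ 0 * q₂ 0 * (q₁ 1 * q₂ 1))]
  have hpos : 0 < ‖q₁s - q₂s‖ * ‖q₁s + q₂s‖ := (mul_pos ha hb).trans_le hle
  have hc : 0 < ‖q₁s - q₂s‖ := pos_of_mul_pos_left hpos (norm_nonneg _)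
  have hd : 0 < ‖q₁s + q₂s‖ := pos_of_mul_pos_right hpos (norm_nonneg _)
  refine ⟨n1, n2, ?_, fun hx hy => ?_⟩
  · unfold redU
    rw [n1, n2]
    linarith [one_div_add_one_div_le ha hb hc hd hsum hle]
  · have hlt : ‖q₁ - q₂‖ * ‖q₁ + q₂‖ < ‖q₁s - q₂s‖ * ‖q₁s + q₂s‖ := by
      refine lt_of_pow_lt_pow_left₀ 2 (by positivity) ?_
      linarith [mul_pos hx hy, abs_nonneg (q₁ 0 * q₂ 0 * (q₁ 1 * q₂ 1))]
    unfold redU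
    rw [n1, n2]
    linarith [one_div_add_one_div_lt ha hb hc hd hsum hlt]

end
end
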